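/- For every n ∈ ℙ, ∑_{γ ∈ Δ_n} q^{Dmaj(γ)} = ∑_{γ ∈ D_n} q^{ℓ_D(γ)}, i.e., the D-major index is Mahonian on D_n. -/

import Mathlib

open Finset Polynomial

/-- The hyperoctahedral group `B n`, modeled as pairs (permutation, sign vector):
the signed permutation with window `β(i) = ±(σ(i)+1)`. -/
abbrev Bgrp (n : ℕ) := Equiv.Perm (Fin n) × (Fin n → Bool)

/-- The window entry `β(i)` (a nonzero integer). -/
def wdw {n : ℕ} (β : Bgrp n) (i : Fin n) : ℤ :=
  (if β.2 i then -1 else 1) * ((β.1 i : ℤ) + 1)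

/-- Window entry at a `ℕ` position (0-based), `0` out of range. -/
def wdwN {n : ℕ} (β : Bgrp n) (i : ℕ) : ℤ :=
  if h : i < n then wdw β ⟨i, h⟩ else 0

/-- Number of inversions of the window. -/
def invB {n : ℕ} (β : Bgrp n) : ℕ :=
  ((univ : Finset (Fin n × Fin n)).filter
    (fun p => p.1 < p.2 ∧ wdw β p.2 < wdw β p.1)).card

/-- The set of positions with negative entries. -/
def NegB {n : ℕ} (β : Bgrp n) : Finset (Fin n) :=
  univ.filter (fun i => wdw β i < 0)

def N1 {n : ℕ} (β : Bgrp n) : ℕ := (NegB β).card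

def N2 {n : ℕ} (β : Bgrp n) : ℕ :=
  ((univ : Finset (Fin n × Fin n)).filter
    (fun p => p.1 < p.2 ∧ wdw β p.1 + wdw β p.2 < 0)).card

/-- The order `-1 ≺ -2 ≺ ⋯ ≺ -n ≺ 1 ≺ 2 ≺ ⋯ ≺ n` on nonzero integers. -/
def precLt (a b : ℤ) : Prop :=
  (a < 0 ∧ b < 0 ∧ b < a) ∨ (a < 0 ∧ 0 < b) ∨ (0 < a ∧ 0 < b ∧ a < b)

instance (a b : ℤ) : Decidable (precLt a b) := by unfold precLt; infer_instance

/-- Descent set of the window, with respect to `≺` (0-based positions). -/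
def DesB {n : ℕ} (β : Bgrp n) : Finset ℕ :=
  (range (n-1)).filter (fun i => precLt (wdwN β (i+1)) (wdwN β i))

/-- Major index: sum of the (1-based) descent positions. -/
def majB {n : ℕ} (β : Bgrp n) : ℕ := ∑ i ∈ DesB β, (i+1)

/-- Flag-major index. -/
def fmaj {n : ℕ} (β : Bgrp n) : ℕ := 2 * majB β + N1 β

/-- Group multiplication (composition of signed permutations). -/
def bmul {n : ℕ} (β γ : Bgrp n) : Bgrp n :=
  (β.1 * γ.1, fun i => xor (γ.2 i) (β.2 (γ.1 i)))

/-- The identity signed permutation. -/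
def bone (n : ℕ) : Bgrp n := (1, fun _ => false)

/-- The Coxeter generators `s_0, s_1, …, s_{n-1}` of `B n`. -/
def BGens (n : ℕ) : Set (Bgrp n) :=
  { b | (∃ h : 0 < n, b = ((1 : Equiv.Perm (Fin n)), fun j => decide (j = (⟨0, h⟩ : Fin n)))) ∨
        (∃ (i : ℕ) (h : i + 1 < n),
          b = (Equiv.swap ⟨i, Nat.lt_of_succ_lt h⟩ ⟨i+1, h⟩, fun _ => false)) }

/-- Minimal length of an expression of `β` as a product of the generators of `B n`. -/
noncomputable def lenB {n : ℕ} (β : Bgrp n) : ℕ :=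
  sInf {k | ∃ l : List (Bgrp n), l.length = k ∧ (∀ g ∈ l, g ∈ BGens n) ∧
    l.foldr bmul (bone n) = β}

/-- The Coxeter generators `s_0^D, s_1, …, s_{n-1}` of `D n`. -/
def DGens (n : ℕ) : Set (Bgrp n) :=
  { b | (∃ h : 1 < n,
          b = (Equiv.swap ⟨0, Nat.lt_of_succ_lt h⟩ ⟨1, h⟩, fun (j : Fin n) => decide ((j : ℕ) < 2))) ∨
        (∃ (i : ℕ) (h : i + 1 < n),
          b = (Equiv.swap ⟨i, Nat.lt_of_succ_lt h⟩ ⟨i+1, h⟩, fun _ => false)) }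

/-- Minimal length of an expression as a product of the generators of `D n`. -/
noncomputable def lenD {n : ℕ} (β : Bgrp n) : ℕ :=
  sInf {k | ∃ l : List (Bgrp n), l.length = k ∧ (∀ g ∈ l, g ∈ DGens n) ∧
    l.foldr bmul (bone n) = β}

/-- The even-signed permutation group `D n` as a finset of `B n`. -/
def Dgrp (n : ℕ) : Finset (Bgrp n) := univ.filter (fun γ => Even (N1 γ))

/-- `Δ_n = {γ ∈ B_n : γ(n) > 0}`. -/
def DeltaSet (n : ℕ) : Finset (Bgrp n) := univ.filter (fun γ => 0 < wdwN γ (n-1))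

/-- `|γ|_n`: replace the last window entry by its absolute value. -/
def absLast {n : ℕ} (γ : Bgrp n) : Bgrp n :=
  (γ.1, fun i => if (i : ℕ) = n - 1 then false else γ.2 i)

/-- The `D`-major index. -/
def Dmaj {n : ℕ} (γ : Bgrp n) : ℕ := fmaj (absLast γ)

/-- `-β`: negate all window entries. -/
def negB {n : ℕ} (β : Bgrp n) : Bgrp n := (β.1, fun i => !β.2 i)

/-- Number of inversions of a permutation of `Fin n`. -/
def invS {n : ℕ} (σ : Equiv.Perm (Fin n)) : ℕ :=
  ((univ : Finset (Fin n × Fin n)).filter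
    (fun p => p.1 < p.2 ∧ σ p.2 < σ p.1)).card

/-- Major index of a permutation of `Fin n` (usual order). -/
def majS {n : ℕ} (σ : Equiv.Perm (Fin n)) : ℕ :=
  ∑ i ∈ (range (n-1)).filter
      (fun i => ∀ h : i + 1 < n, σ ⟨i+1, h⟩ < σ ⟨i, Nat.lt_of_succ_lt h⟩), (i+1)

/-- The `q`-analogue `[m]_q = 1 + q + ⋯ + q^{m-1}`, evaluated at a polynomial `q`. -/
noncomputable def qpoly (m : ℕ) (q : Polynomial ℤ) : Polynomial ℤ := ∑ k ∈ range m, q ^ k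

/-- For `x = (k, ε)`, the signed permutation with last window entry `±(k+1)`, negative iff `ε`,
whose other entries standardize to the window of `β`. -/
def appendLetter {n : ℕ} (x : Fin (n + 1) × Bool) (β : Bgrp n) : Bgrp (n + 1) :=
  ((finSuccEquiv' (Fin.last n)).trans ((Equiv.optionCongr β.1).trans (finSuccEquiv' x.1).symm),
    Fin.lastCases x.2 β.2)

section appendLetter

variable {n : ℕ} (x : Fin (n + 1) × Bool) (β : Bgrp n)

lemma appendLetter_fst_last : (appendLetter x β).1 (Fin.last n) = x.1 := by
  simp [appendLetter]

lemma appendLetter_fst_castSucc (i : Fin n) :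
    (appendLetter x β).1 i.castSucc = x.1.succAbove (β.1 i) := by
  rw [← Fin.succAbove_last_apply]
  simp only [appendLetter, Equiv.trans_apply, finSuccEquiv'_succAbove]
  simp

lemma appendLetter_snd_last : (appendLetter x β).2 (Fin.last n) = x.2 := by
  simp [appendLetter]

lemma appendLetter_snd_castSucc (i : Fin n) : (appendLetter x β).2 i.castSucc = β.2 i := by
  simp [appendLetter]

lemma appendLetter_bijective :
    Function.Bijective (fun p : (Fin (n + 1) × Bool) × Bgrp n => appendLetter p.1 p.2) := by
  rw [Fintype.bijective_iff_injective_and_card]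
  constructor
  · rintro ⟨x, β⟩ ⟨y, γ⟩ h
    simp only at h
    have hx : x = y := Prod.ext
      (by rw [← appendLetter_fst_last x β, h, appendLetter_fst_last])
      (by rw [← appendLetter_snd_last x β, h, appendLetter_snd_last])
    subst hx
    have hβ : β = γ := by
      refine Prod.ext (Equiv.ext fun i => ?_) (funext fun i => ?_)
      · have := appendLetter_fst_castSucc x β i
        rw [h, appendLetter_fst_castSucc] at this
        exact (Fin.succAbove_right_injective this).symm
      · rw [← appendLetter_snd_castSucc x β, h, appendLetter_snd_castSucc]
    rw [hβ]
  · simp only [Fintype.card_prod, Fintype.card_fin, Fintype.card_bool, Fintype.card_perm,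
      Fintype.card_fun, Nat.factorial_succ]
    ring

lemma sum_Bgrp_succ {M : Type*} [AddCommMonoid M] (f : Bgrp (n + 1) → M) :
    ∑ γ, f γ = ∑ x, ∑ β, f (appendLetter x β) := by
  rw [← Fintype.sum_prod_type']
  exact (Function.Bijective.sum_comp appendLetter_bijective f).symm

lemma wdw_appendLetter_last :
    wdw (appendLetter x β) (Fin.last n) = (if x.2 then -1 else 1) * ((x.1 : ℤ) + 1) := by
  rw [wdw, appendLetter_fst_last, appendLetter_snd_last]

lemma val_succAbove (k : Fin (n + 1)) (a : Fin n) :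
    (k.succAbove a : ℕ) = if (a : ℕ) < k then (a : ℕ) else a + 1 := by
  simp only [Fin.succAbove, Fin.lt_def, Fin.val_castSucc]
  split_ifs <;> simp

lemma wdw_appendLetter_castSucc (i : Fin n) :
    wdw (appendLetter x β) i.castSucc =
      (if β.2 i then -1 else 1) *
        ((if (β.1 i : ℕ) < x.1 then (β.1 i : ℤ) else (β.1 i : ℤ) + 1) + 1) := by
  rw [wdw, appendLetter_fst_castSucc, appendLetter_snd_castSucc, val_succAbove]
  push_cast
  rfl

lemma wdw_neg_iff (i : Fin n) : wdw β i < 0 ↔ β.2 i = true := by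
  unfold wdw
  cases β.2 i <;> simp <;> omega

lemma N1_eq_sum : N1 β = ∑ i, if β.2 i then 1 else 0 := by
  rw [N1, NegB, Finset.card_filter]
  simp only [wdw_neg_iff]

lemma N1_appendLetter : N1 (appendLetter x β) = N1 β + if x.2 then 1 else 0 := by
  simp only [N1_eq_sum, Fin.sum_univ_castSucc, appendLetter_snd_castSucc, appendLetter_snd_last]

lemma precLt_wdw_appendLetter_castSucc (i j : Fin n) :
    precLt (wdw (appendLetter x β) i.castSucc) (wdw (appendLetter x β) j.castSucc) ↔
      precLt (wdw β i) (wdw β j) := by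
  simp only [wdw_appendLetter_castSucc]
  simp only [wdw, precLt]
  generalize β.2 i = a
  generalize β.2 j = b
  cases a <;> cases b <;> simp <;> split_ifs <;> omega

end appendLetter

lemma majB_eq_sum {n : ℕ} (β : Bgrp n) :
    majB β = ∑ i ∈ range (n - 1), if precLt (wdwN β (i + 1)) (wdwN β i) then i + 1 else 0 := by
  rw [majB, DesB, Finset.sum_filter]

lemma wdwN_of_lt {n : ℕ} (β : Bgrp n) {i : ℕ} (h : i < n) : wdwN β i = wdw β ⟨i, h⟩ := by
  simp [wdwN, h]

lemma majB_appendLetter {n : ℕ} (x : Fin (n + 2) × Bool) (β : Bgrp (n + 1)) :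
    majB (appendLetter x β) = majB β +
      if precLt (wdw (appendLetter x β) (Fin.last _))
        (wdw (appendLetter x β) (Fin.last n).castSucc) then n + 1 else 0 := by
  rw [majB_eq_sum, majB_eq_sum]
  simp only [Nat.add_sub_cancel]
  rw [Finset.sum_range_succ]
  congr 1
  · refine Finset.sum_congr rfl fun i hi => ?_
    have hi' : i < n := Finset.mem_range.1 hi
    rw [wdwN_of_lt _ (by omega : i + 1 < n + 1 + 1), wdwN_of_lt _ (by omega : i < n + 1 + 1),
      wdwN_of_lt _ (by omega : i + 1 < n + 1), wdwN_of_lt _ (by omega : i < n + 1)]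
    have := precLt_wdw_appendLetter_castSucc x β ⟨i + 1, by omega⟩ ⟨i, by omega⟩
    simp only [Fin.castSucc_mk] at this
    simp only [this]
  · rw [wdwN_of_lt _ (by omega : n + 1 < n + 1 + 1), wdwN_of_lt _ (by omega : n < n + 1 + 1)]
    rfl

/-- The number of letters among `±1, …, ±(n+1)` strictly above the given one in the order `≺`. -/
def letterCorank {n : ℕ} (x : Fin (n + 1) × Bool) : ℕ :=
  n - x.1 + if x.2 then n + 1 else 0

/-- The increment of `fmaj` when the letter `x` is appended to a window ending in `y`. -/
def fmajIncr {n : ℕ} (x : Fin (n + 2) × Bool) (y : Fin (n + 1) × Bool) : ℕ :=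
  (if x.2 then 1 else 0) +
    if (if x.2 then y.2 = true → (x.1 : ℕ) ≤ y.1 else y.2 = false ∧ (x.1 : ℕ) ≤ y.1)
      then 2 * (n + 1) else 0

lemma fmaj_appendLetter_appendLetter {n : ℕ} (x : Fin (n + 2) × Bool) (y : Fin (n + 1) × Bool)
    (β : Bgrp n) :
    fmaj (appendLetter x (appendLetter y β)) = fmajIncr x y + fmaj (appendLetter y β) := by
  have key : precLt (wdw (appendLetter x (appendLetter y β)) (Fin.last _))
        (wdw (appendLetter x (appendLetter y β)) (Fin.last n).castSucc) ↔
      (if x.2 then y.2 = true → (x.1 : ℕ) ≤ y.1 else y.2 = false ∧ (x.1 : ℕ) ≤ y.1) := by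
    rw [wdw_appendLetter_last, wdw_appendLetter_castSucc, appendLetter_snd_last,
      appendLetter_fst_last]
    obtain ⟨k, a⟩ := x
    obtain ⟨l, b⟩ := y
    simp only [precLt]
    cases a <;> cases b <;> simp <;> split_ifs <;> omega
  rw [fmaj, majB_appendLetter, N1_appendLetter, fmaj, fmajIncr]
  simp only [key]
  split_ifs <;> omega

/-- The polynomial `[m]_q` in the variable `X`. -/
noncomputable def qInt (m : ℕ) : ℤ[X] := ∑ k ∈ range m, X ^ k

lemma sum_X_pow_fmajIncr {n : ℕ} (x : Fin (n + 2) × Bool) :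
    ∑ y, (X : ℤ[X]) ^ (fmajIncr x y + letterCorank y) =
      X ^ letterCorank x * qInt (2 * (n + 1)) := by
  have hinj : Function.Injective
      (fun y : Fin (n + 1) × Bool => fmajIncr x y + letterCorank y) := by
    rintro ⟨⟨l, hl⟩, b⟩ ⟨⟨m, hm⟩, c⟩ h
    obtain ⟨⟨k, hk⟩, a⟩ := x
    revert h
    cases a <;> cases b <;> cases c <;> simp [fmajIncr, letterCorank] <;> grind
  have himg : univ.image (fun y => fmajIncr x y + letterCorank y) =
      (range (2 * (n + 1))).image (fun k => letterCorank x + k) := by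
    refine Finset.eq_of_subset_of_card_le ?_ ?_
    · intro m
      simp only [mem_image, mem_univ, true_and, mem_range]
      rintro ⟨y, rfl⟩
      refine ⟨fmajIncr x y + letterCorank y - letterCorank x, ?_⟩
      obtain ⟨⟨k, hk⟩, a⟩ := x
      obtain ⟨⟨l, hl⟩, b⟩ := y
      cases a <;> cases b <;> simp [fmajIncr, letterCorank] <;> grind
    · rw [Finset.card_image_of_injective _ (add_right_injective _),
        Finset.card_image_of_injective _ hinj]
      simp [mul_comm]
  have h := Finset.sum_image (s := univ) (f := fun m => (X : ℤ[X]) ^ m) hinj.injOn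
  rw [himg, Finset.sum_image (add_right_injective _).injOn] at h
  rw [← h, qInt, Finset.mul_sum]
  simp only [pow_add]

lemma N1_bone (n : ℕ) : N1 (bone n) = 0 := by
  simp [N1_eq_sum, bone]

lemma sum_X_pow_fmaj_appendLetter {n : ℕ} (x : Fin (n + 1) × Bool) :
    ∑ β : Bgrp n, (X : ℤ[X]) ^ fmaj (appendLetter x β) =
      X ^ letterCorank x * ∏ i ∈ range n, qInt (2 * (i + 1)) := by
  induction n with
  | zero =>
    rw [Fintype.sum_subsingleton _ (bone 0), fmaj, N1_appendLetter, N1_bone]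
    simp [majB_eq_sum, letterCorank]
  | succ n ih =>
    rw [sum_Bgrp_succ]
    simp only [fmaj_appendLetter_appendLetter, pow_add, ← Finset.mul_sum, ih]
    simp only [← mul_assoc, ← Finset.sum_mul, ← pow_add]
    rw [sum_X_pow_fmajIncr, Finset.prod_range_succ]
    ring

lemma sum_X_pow_sub (n : ℕ) : ∑ k : Fin (n + 1), (X : ℤ[X]) ^ (n - k : ℕ) = qInt (n + 1) := by
  rw [Fin.sum_univ_eq_sum_range (fun k => (X : ℤ[X]) ^ (n - k)) (n + 1), qInt]
  exact Finset.sum_range_reflect (fun k => (X : ℤ[X]) ^ k) (n + 1)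

lemma wdwN_last_pos_iff {n : ℕ} (x : Fin (n + 1) × Bool) (β : Bgrp n) :
    0 < wdwN (appendLetter x β) (n + 1 - 1) ↔ x.2 = false := by
  rw [wdwN_of_lt _ (by omega)]
  change 0 < wdw (appendLetter x β) (Fin.last n) ↔ _
  rw [wdw_appendLetter_last]
  cases x.2 <;> simp

lemma absLast_appendLetter {n : ℕ} (k : Fin (n + 1)) (β : Bgrp n) :
    absLast (appendLetter (k, false) β) = appendLetter (k, false) β := by
  refine Prod.ext rfl (funext fun i => ?_)
  refine Fin.lastCases ?_ (fun i => ?_) i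
  · simp [absLast, appendLetter_snd_last]
  · simp [absLast, i.isLt.ne]

theorem sum_DeltaSet_X_pow_Dmaj (n : ℕ) :
    ∑ γ ∈ DeltaSet (n + 1), (X : ℤ[X]) ^ Dmaj γ =
      qInt (n + 1) * ∏ i ∈ range n, qInt (2 * (i + 1)) := by
  rw [DeltaSet, Finset.sum_filter, sum_Bgrp_succ]
  simp only [wdwN_last_pos_iff]
  rw [Fintype.sum_prod_type]
  simp only [Fintype.sum_bool, Bool.true_eq_false, if_false, Finset.sum_const_zero, zero_add,
    if_true, Dmaj, absLast_appendLetter, sum_X_pow_fmaj_appendLetter]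
  rw [← Finset.sum_mul, ← sum_X_pow_sub]
  simp [letterCorank]

/-- The contribution of a pair of window entries to the length in type `D`. -/
def pairD (a b : ℤ) : ℕ := (if b < a then 1 else 0) + if a + b < 0 then 1 else 0

/-- The number of inversions plus the number of negative sum pairs of the window. -/
def statD {n : ℕ} (β : Bgrp n) : ℕ :=
  ∑ p : Fin n × Fin n, if p.1 < p.2 then pairD (wdw β p.1) (wdw β p.2) else 0

lemma wdw_bmul {n : ℕ} (β γ : Bgrp n) (i : Fin n) :
    wdw (bmul β γ) i = (if γ.2 i then -1 else 1) * wdw β (γ.1 i) := by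
  simp only [wdw, bmul, Equiv.Perm.mul_apply]
  rcases Bool.eq_false_or_eq_true (γ.2 i) with h | h <;>
    rcases Bool.eq_false_or_eq_true (β.2 (γ.1 i)) with h' | h' <;> simp [h, h']

lemma wdw_natAbs {n : ℕ} (β : Bgrp n) (i : Fin n) : (wdw β i).natAbs = β.1 i + 1 := by
  unfold wdw
  cases β.2 i <;> simp <;> omega

lemma wdw_natAbs_ne {n : ℕ} (β : Bgrp n) {i j : Fin n} (h : i ≠ j) :
    (wdw β i).natAbs ≠ (wdw β j).natAbs := by
  rw [wdw_natAbs, wdw_natAbs]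
  intro e
  exact h (β.1.injective (Fin.ext (by omega)))

/-- The generator `s_{i+1}`, transposing the positions `i` and `i + 1` (0-based). -/
def swapGen {n : ℕ} (i : ℕ) (h : i + 1 < n) : Bgrp n :=
  (Equiv.swap ⟨i, Nat.lt_of_succ_lt h⟩ ⟨i + 1, h⟩, fun _ => false)

/-- The generator `s_0^D`. -/
def zeroGen {n : ℕ} (h : 1 < n) : Bgrp n :=
  (Equiv.swap ⟨0, Nat.lt_of_succ_lt h⟩ ⟨1, h⟩, fun j => decide ((j : ℕ) < 2))

lemma mem_DGens {n : ℕ} (g : Bgrp n) :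
    g ∈ DGens n ↔ (∃ h : 1 < n, g = zeroGen h) ∨ ∃ i, ∃ h : i + 1 < n, g = swapGen i h :=
  Iff.rfl

lemma sum_pairs_swap {n : ℕ} (i : ℕ) (h : i + 1 < n) (f : Fin n → Fin n → ℕ) :
    (∑ p : Fin n × Fin n, if p.1 < p.2 then
        f (Equiv.swap ⟨i, Nat.lt_of_succ_lt h⟩ ⟨i + 1, h⟩ p.1)
          (Equiv.swap ⟨i, Nat.lt_of_succ_lt h⟩ ⟨i + 1, h⟩ p.2) else 0) +
        f ⟨i, Nat.lt_of_succ_lt h⟩ ⟨i + 1, h⟩ =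
      (∑ p : Fin n × Fin n, if p.1 < p.2 then f p.1 p.2 else 0) +
        f ⟨i + 1, h⟩ ⟨i, Nat.lt_of_succ_lt h⟩ := by
  set a : Fin n := ⟨i, Nat.lt_of_succ_lt h⟩ with ha
  set b : Fin n := ⟨i + 1, h⟩ with hb
  have hab : a < b := by simp [ha, hb]
  set s := Equiv.swap a b with hs
  have hlt : ∀ p q : Fin n, (p, q) ≠ (a, b) → (p, q) ≠ (b, a) → (s p < s q ↔ p < q) := by
    intro p q h1 h2
    simp only [ne_eq, Prod.mk.injEq] at h1 h2
    simp only [hs, Equiv.swap_apply_def]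
    simp only [Fin.lt_def, Fin.ext_iff, ha, hb] at *
    split_ifs <;> simp <;> omega
  have e : (∑ p : Fin n × Fin n, if p.1 < p.2 then f (s p.1) (s p.2) else 0) =
      ∑ p : Fin n × Fin n, if s p.1 < s p.2 then f p.1 p.2 else 0 := by
    rw [← (Equiv.prodCongr s s).sum_comp]
    refine Finset.sum_congr rfl fun p _ => ?_
    simp [hs]
  have hne : (a, b) ≠ (b, a) := fun e => hab.ne (Prod.ext_iff.1 e).1
  have hmem : (b, a) ∈ (univ : Finset (Fin n × Fin n)).erase (a, b) := by
    simp [hne.symm]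
  rw [e, ← Finset.add_sum_erase _ _ (Finset.mem_univ (a, b)),
    ← Finset.add_sum_erase _ _ hmem,
    ← Finset.add_sum_erase (univ : Finset (Fin n × Fin n)) (fun p => if p.1 < p.2 then _ else _)
      (Finset.mem_univ (a, b)),
    ← Finset.add_sum_erase _ (fun p : Fin n × Fin n => if p.1 < p.2 then f p.1 p.2 else 0) hmem]
  have hrest : ∀ p ∈ ((univ : Finset (Fin n × Fin n)).erase (a, b)).erase (b, a),
      (if s p.1 < s p.2 then f p.1 p.2 else 0) = if p.1 < p.2 then f p.1 p.2 else 0 := by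
    intro p hp
    simp only [Finset.mem_erase, Finset.mem_univ, and_true] at hp
    rw [if_congr (hlt p.1 p.2 hp.2 hp.1) rfl rfl]
  rw [Finset.sum_congr rfl hrest]
  simp only [hs, Equiv.swap_apply_left, Equiv.swap_apply_right, hab, hab.not_gt, if_true,
    if_false]
  ring

lemma statD_bmul_swapGen {n : ℕ} (β : Bgrp n) (i : ℕ) (h : i + 1 < n) :
    statD (bmul β (swapGen i h)) +
        pairD (wdw β ⟨i, Nat.lt_of_succ_lt h⟩) (wdw β ⟨i + 1, h⟩) =
      statD β + pairD (wdw β ⟨i + 1, h⟩) (wdw β ⟨i, Nat.lt_of_succ_lt h⟩) := by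
  rw [statD, statD, ← sum_pairs_swap i h (fun p q => pairD (wdw β p) (wdw β q))]
  simp [wdw_bmul, swapGen]

lemma pairD_neg_left (a b : ℤ) : pairD (-a) b = pairD a b := by
  unfold pairD
  split_ifs <;> omega

lemma statD_bmul_zeroGen {n : ℕ} (β : Bgrp n) (h : 1 < n) :
    statD (bmul β (zeroGen h)) +
        pairD (wdw β ⟨0, Nat.lt_of_succ_lt h⟩) (wdw β ⟨1, h⟩) =
      statD β + pairD (-wdw β ⟨1, h⟩) (-wdw β ⟨0, Nat.lt_of_succ_lt h⟩) := by
  have key := sum_pairs_swap 0 h (fun p q => if (p : ℕ) < 2 ∧ (q : ℕ) < 2 ∧ q < p then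
    pairD (-wdw β p) (-wdw β q) else pairD (wdw β p) (wdw β q))
  rw [statD, statD]
  simp only [zero_add] at key
  convert key using 2
  · refine Finset.sum_congr rfl fun p _ => ?_
    obtain ⟨p, q⟩ := p
    by_cases hpq : p < q
    · simp only [hpq, if_true, wdw_bmul, zeroGen]
      by_cases hq : (q : ℕ) < 2
      · have hp0 : p = ⟨0, Nat.lt_of_succ_lt h⟩ := Fin.ext (by simp; omega)
        have hq1 : q = ⟨1, h⟩ := Fin.ext (by simp; omega)
        subst hp0 hq1
        simp
      · have hqs : Equiv.swap (⟨0, Nat.lt_of_succ_lt h⟩ : Fin n) ⟨1, h⟩ q = q :=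
          Equiv.swap_apply_of_ne_of_ne (by rintro rfl; simp at hq) (by rintro rfl; simp at hq)
        rw [hqs]
        simp only [hq, decide_false, false_and, and_false, if_false]
        by_cases hp : (p : ℕ) < 2 <;> simp [hp, pairD_neg_left]
    · simp [hpq]
  · simp
  · refine Finset.sum_congr rfl fun p _ => ?_
    by_cases hpq : p.1 < p.2
    · simp [hpq, hpq.not_gt]
    · simp [hpq]
  · simp

lemma statD_bmul_le {n : ℕ} (β g : Bgrp n) (hg : g ∈ DGens n) :
    statD (bmul β g) ≤ statD β + 1 := by
  rcases (mem_DGens g).1 hg with ⟨h, rfl⟩ | ⟨i, h, rfl⟩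
  · have := statD_bmul_zeroGen β h
    unfold pairD at this
    split_ifs at this <;> omega
  · have := statD_bmul_swapGen β i h
    unfold pairD at this
    split_ifs at this <;> omega

lemma bmul_assoc {n : ℕ} (a b c : Bgrp n) : bmul (bmul a b) c = bmul a (bmul b c) := by
  refine Prod.ext (mul_assoc _ _ _) (funext fun i => ?_)
  simp [bmul]

lemma bmul_bone {n : ℕ} (a : Bgrp n) : bmul a (bone n) = a := by
  simp [bmul, bone]

lemma bone_bmul {n : ℕ} (a : Bgrp n) : bmul (bone n) a = a := by
  simp [bmul, bone]

lemma foldr_bmul_concat {n : ℕ} (l : List (Bgrp n)) (g : Bgrp n) :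
    (l ++ [g]).foldr bmul (bone n) = bmul (l.foldr bmul (bone n)) g := by
  induction l with
  | nil => simp [bmul_bone, bone_bmul]
  | cons a l ih => simp only [List.cons_append, List.foldr_cons, ih, bmul_assoc]

lemma bmul_self_of_mem_DGens {n : ℕ} {g : Bgrp n} (hg : g ∈ DGens n) : bmul g g = bone n := by
  rcases (mem_DGens g).1 hg with ⟨h, rfl⟩ | ⟨i, h, rfl⟩
  · refine Prod.ext (by simp [bmul, zeroGen, bone]) (funext fun j => ?_)
    simp only [bmul, zeroGen, bone]
    by_cases hj : (j : ℕ) < 2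
    · obtain rfl | rfl : j = ⟨0, Nat.lt_of_succ_lt h⟩ ∨ j = ⟨1, h⟩ := by
        simp only [Fin.ext_iff]; omega
      · simp
      · simp
    · rw [Equiv.swap_apply_of_ne_of_ne (by rintro rfl; simp at hj) (by rintro rfl; simp at hj)]
      simp
  · exact Prod.ext (by simp [bmul, swapGen, bone]) (funext fun j => by simp [bmul, swapGen, bone])

lemma statD_bone (n : ℕ) : statD (bone n) = 0 := by
  refine Finset.sum_eq_zero fun p _ => ?_
  split_ifs with h
  · simp only [Fin.lt_def] at h
    simp [pairD, wdw, bone]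
    omega
  · rfl

lemma statD_foldr_le {n : ℕ} (l : List (Bgrp n)) (hl : ∀ g ∈ l, g ∈ DGens n) :
    statD (l.foldr bmul (bone n)) ≤ l.length := by
  induction l using List.reverseRecOn with
  | nil => simp [statD_bone]
  | append_singleton l g ih =>
    rw [foldr_bmul_concat]
    have h1 := statD_bmul_le (l.foldr bmul (bone n)) g (hl g (by simp))
    have h2 := ih fun g hg => hl g (by simp [hg])
    simp only [List.length_append, List.length_singleton]
    omega

lemma natCast_N1_bmul {n : ℕ} (β γ : Bgrp n) :
    (N1 (bmul β γ) : ZMod 2) = N1 β + N1 γ := by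
  simp only [N1_eq_sum, Nat.cast_sum]
  rw [← Equiv.sum_comp γ.1 (fun i => ((if β.2 i then 1 else 0 : ℕ) : ZMod 2)),
    ← Finset.sum_add_distrib]
  refine Finset.sum_congr rfl fun i _ => ?_
  simp only [bmul]
  rcases Bool.eq_false_or_eq_true (γ.2 i) with h | h <;>
    rcases Bool.eq_false_or_eq_true (β.2 (γ.1 i)) with h' | h' <;> simp [h, h']
  decide

lemma even_N1_of_mem_DGens {n : ℕ} {g : Bgrp n} (hg : g ∈ DGens n) : Even (N1 g) := by
  rcases (mem_DGens g).1 hg with ⟨h, rfl⟩ | ⟨i, h, rfl⟩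
  · obtain ⟨m, rfl⟩ : ∃ m, n = m + 2 := ⟨n - 2, by omega⟩
    rw [N1_eq_sum, Fin.sum_univ_succ, Fin.sum_univ_succ, Finset.sum_eq_zero]
    · simp [zeroGen]
    · simp [zeroGen]
  · simp [N1_eq_sum, swapGen]

lemma even_N1_bmul {n : ℕ} {β g : Bgrp n} (hβ : Even (N1 β)) (hg : g ∈ DGens n) :
    Even (N1 (bmul β g)) := by
  have hg := even_N1_of_mem_DGens hg
  rw [← ZMod.natCast_eq_zero_iff_even] at *
  rw [natCast_N1_bmul, hβ, hg, add_zero]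

/-- An increasing window with an even number of negative entries whose first two entries have
positive sum is the identity. -/
lemma eq_bone_of_increasing {n : ℕ} {β : Bgrp n} (hβ : Even (N1 β))
    (hinc : ∀ i (h : i + 1 < n), wdw β ⟨i, Nat.lt_of_succ_lt h⟩ < wdw β ⟨i + 1, h⟩)
    (hpos : ∀ h : 1 < n, 0 < wdw β ⟨0, Nat.lt_of_succ_lt h⟩ + wdw β ⟨1, h⟩) : β = bone n := by
  have hsucc : ∀ i (h : i + 1 < n), 0 < wdw β ⟨i + 1, h⟩ := by
    intro i
    induction i with
    | zero =>
      intro h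
      have h1 := hinc 0 h
      have h2 := hpos h
      simp only [zero_add] at *
      omega
    | succ i ih =>
      intro h
      exact (ih (by omega)).trans (hinc (i + 1) h)
  have hsgn : ∀ i (h : i + 1 < n), β.2 ⟨i + 1, h⟩ = false := by
    intro i h
    have := wdw_neg_iff β ⟨i + 1, h⟩
    have h' := hsucc i h
    rw [← Bool.not_eq_true, ← this]
    omega
  have hmono : StrictMono β.1 := by
    cases n with
    | zero => exact fun i => i.elim0
    | succ n =>
      rw [Fin.strictMono_iff_lt_succ]
      intro i
      have h1 := wdw_natAbs β i.castSucc
      have h2 := wdw_natAbs β i.succ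
      have h3 := hinc i (by omega)
      have h4 : 0 < wdw β i.succ := hsucc i (by omega)
      have h6 : 0 < wdw β i.castSucc + wdw β i.succ := by
        rcases Nat.eq_zero_or_pos (i : ℕ) with h0 | h0
        · have := hpos (by omega)
          have e1 : i.castSucc = ⟨0, by omega⟩ := Fin.ext h0
          have e2 : i.succ = ⟨1, by omega⟩ := Fin.ext (by simp [h0])
          rwa [e1, e2]
        · have := hsucc (i - 1) (by omega)
          have e1 : i.castSucc = ⟨i - 1 + 1, by omega⟩ := Fin.ext (by simp; omega)
          rw [← e1] at this
          omega
      have h7 : wdw β i.castSucc < wdw β i.succ := h3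
      rw [Fin.lt_def]
      omega
  have hid : β.1 = 1 := by
    ext i
    exact congrArg Fin.val (congrFun (congrArg DFunLike.coe
      (Subsingleton.elim (hmono.orderIsoOfSurjective _ β.1.surjective) (OrderIso.refl _))) i)
  refine Prod.ext hid (funext fun i => ?_)
  obtain ⟨i, hi⟩ := i
  cases i with
  | succ i => exact hsgn i hi
  | zero =>
    obtain ⟨m, rfl⟩ : ∃ m, n = m + 1 := ⟨n - 1, by omega⟩
    rw [N1_eq_sum, Fin.sum_univ_succ, Finset.sum_eq_zero (s := univ)
      (fun j _ => by
        have : β.2 j.succ = false := hsgn j (by omega)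
        simp [this])] at hβ
    change β.2 0 = false
    by_contra hc
    rw [Bool.not_eq_false] at hc
    rw [hc] at hβ
    simp at hβ

lemma exists_gen_statD_lt {n : ℕ} {β : Bgrp n} (hβ : Even (N1 β)) (hne : β ≠ bone n) :
    ∃ g ∈ DGens n, statD (bmul β g) + 1 = statD β := by
  by_contra! hcon
  refine hne (eq_bone_of_increasing hβ (fun i h => ?_) fun h => ?_)
  · have h1 := hcon _ ((mem_DGens _).2 (Or.inr ⟨i, h, rfl⟩))
    have h2 := statD_bmul_swapGen β i h
    have h3 := wdw_natAbs_ne β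
      (i := ⟨i, Nat.lt_of_succ_lt h⟩) (j := ⟨i + 1, h⟩) (by simp)
    unfold pairD at h2
    split_ifs at h2 <;> omega
  · have h1 := hcon _ ((mem_DGens _).2 (Or.inl ⟨h, rfl⟩))
    have h2 := statD_bmul_zeroGen β h
    have h3 := wdw_natAbs_ne β (i := ⟨0, Nat.lt_of_succ_lt h⟩) (j := ⟨1, h⟩) (by simp)
    unfold pairD at h2
    split_ifs at h2 <;> omega

lemma exists_word_of_even {n : ℕ} (β : Bgrp n) (hβ : Even (N1 β)) :
    ∃ l : List (Bgrp n), l.length = statD β ∧ (∀ g ∈ l, g ∈ DGens n) ∧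
      l.foldr bmul (bone n) = β := by
  induction hm : statD β using Nat.strong_induction_on generalizing β with
  | _ m ih =>
    by_cases hne : β = bone n
    · exact ⟨[], by simp [← hm, hne, statD_bone], by simp, hne.symm⟩
    · obtain ⟨g, hg, hlt⟩ := exists_gen_statD_lt hβ hne
      obtain ⟨l, h1, h2, h3⟩ := ih _ (by omega) (bmul β g) (even_N1_bmul hβ hg) rfl
      refine ⟨l ++ [g], by simp; omega, ?_, ?_⟩
      · intro g' hg'
        rcases List.mem_append.1 hg' with h | h
        · exact h2 _ h
        · rwa [List.mem_singleton.1 h]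
      · rw [foldr_bmul_concat, h3, bmul_assoc, bmul_self_of_mem_DGens hg, bmul_bone]

theorem lenD_eq_statD {n : ℕ} (β : Bgrp n) (hβ : Even (N1 β)) : lenD β = statD β := by
  refine le_antisymm (Nat.sInf_le (exists_word_of_even β hβ)) ?_
  refine le_csInf ⟨_, exists_word_of_even β hβ⟩ ?_
  rintro k ⟨l, rfl, hl, rfl⟩
  exact statD_foldr_le l hl

lemma pairD_wdw_appendLetter_castSucc {n : ℕ} (x : Fin (n + 1) × Bool) (β : Bgrp n)
    (i j : Fin n) :
    pairD (wdw (appendLetter x β) i.castSucc) (wdw (appendLetter x β) j.castSucc) =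
      pairD (wdw β i) (wdw β j) := by
  simp only [wdw_appendLetter_castSucc]
  simp only [wdw, pairD]
  rcases Bool.eq_false_or_eq_true (β.2 i) with h | h <;>
    rcases Bool.eq_false_or_eq_true (β.2 j) with h' | h' <;>
    simp only [h, h', if_true, if_false, Bool.false_eq_true] <;> split_ifs <;> omega

lemma pairD_wdw_appendLetter_last {n : ℕ} (x : Fin (n + 1) × Bool) (β : Bgrp n) (i : Fin n) :
    pairD (wdw (appendLetter x β) i.castSucc) (wdw (appendLetter x β) (Fin.last n)) =
      if x.2 then 1 + (if (β.1 i : ℕ) < x.1 then 1 else 0)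
        else if (β.1 i : ℕ) < x.1 then 0 else 1 := by
  rw [wdw_appendLetter_castSucc, wdw_appendLetter_last]
  simp only [pairD]
  rcases Bool.eq_false_or_eq_true (β.2 i) with h | h <;>
    rcases Bool.eq_false_or_eq_true x.2 with h' | h' <;>
    simp only [h, h', if_true, if_false, Bool.false_eq_true] <;> split_ifs <;> omega

lemma sum_range_ite_lt (n k : ℕ) (hk : k ≤ n) :
    (∑ a ∈ range n, if a < k then 1 else 0) = k := by
  rw [← Finset.card_filter]
  have : (range n).filter (· < k) = range k := by ext; simp; omega
  rw [this, card_range]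

lemma sum_pairD_wdw_appendLetter_last {n : ℕ} (x : Fin (n + 1) × Bool) (β : Bgrp n) :
    ∑ i : Fin n,
        pairD (wdw (appendLetter x β) i.castSucc) (wdw (appendLetter x β) (Fin.last n)) =
      if x.2 then n + x.1 else n - x.1 := by
  simp only [pairD_wdw_appendLetter_last]
  have h := sum_range_ite_lt n x.1 (by omega)
  rw [← Fin.sum_univ_eq_sum_range (fun a => if a < (x.1 : ℕ) then 1 else 0) n,
    ← Equiv.sum_comp β.1] at h
  split_ifs
  · rw [Finset.sum_add_distrib, h]
    simp
  · have h' : (∑ i : Fin n, if (β.1 i : ℕ) < x.1 then 1 else 0) +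
        (∑ i : Fin n, if (β.1 i : ℕ) < x.1 then 0 else 1) = n := by
      rw [← Finset.sum_add_distrib]
      refine (Finset.sum_congr rfl (g := fun _ => 1) fun i _ => ?_).trans (by simp)
      split_ifs <;> rfl
    omega

lemma statD_appendLetter {n : ℕ} (x : Fin (n + 1) × Bool) (β : Bgrp n) :
    statD (appendLetter x β) = statD β + if x.2 then n + x.1 else n - x.1 := by
  rw [← sum_pairD_wdw_appendLetter_last x β]
  simp only [statD, Fintype.sum_prod_type, Fin.sum_univ_castSucc,
    pairD_wdw_appendLetter_castSucc, Fin.castSucc_lt_castSucc_iff, Fin.castSucc_lt_last, if_true,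
    Finset.sum_add_distrib, (Fin.castSucc_lt_last _).not_gt, lt_irrefl, if_false,
    Finset.sum_const_zero, add_zero]

/-- The generating function of `statD` on the coset of `D_n` of the given parity. -/
noncomputable def genD (n : ℕ) (b : Bool) : ℤ[X] :=
  ∑ β : Bgrp n, if N1 β % 2 = b.toNat then X ^ statD β else 0

lemma sum_X_pow_add (n : ℕ) :
    ∑ k : Fin (n + 1), (X : ℤ[X]) ^ (n + k : ℕ) = X ^ n * qInt (n + 1) := by
  rw [Fin.sum_univ_eq_sum_range (fun k => (X : ℤ[X]) ^ (n + k)) (n + 1), qInt, Finset.mul_sum]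
  simp only [pow_add]

lemma genD_succ (n : ℕ) (b : Bool) :
    genD (n + 1) b = qInt (n + 1) * genD n b + X ^ n * qInt (n + 1) * genD n (!b) := by
  rw [genD, sum_Bgrp_succ, Fintype.sum_prod_type]
  simp only [Fintype.sum_bool, statD_appendLetter, N1_appendLetter, if_true, Bool.false_eq_true,
    if_false, add_zero, Finset.sum_add_distrib]
  rw [add_comm, ← sum_X_pow_add, ← sum_X_pow_sub, genD, genD]
  simp only [Finset.sum_mul_sum]
  congr 1
  · refine Finset.sum_congr rfl fun k _ => Finset.sum_congr rfl fun β _ => ?_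
    rw [pow_add, mul_ite, mul_zero, mul_comm]
  · refine Finset.sum_congr rfl fun k _ => Finset.sum_congr rfl fun β _ => ?_
    have : (N1 β + 1) % 2 = b.toNat ↔ N1 β % 2 = (!b).toNat := by
      cases b <;> simp <;> omega
    simp only [this, pow_add, mul_ite, mul_zero]
    rw [mul_comm]

lemma qInt_two_mul (m : ℕ) : qInt (2 * m) = qInt m * (1 + X ^ m) := by
  rw [two_mul, qInt, Finset.sum_range_add, qInt, mul_add, mul_one, mul_comm _ (X ^ m),
    Finset.mul_sum]
  simp only [pow_add]

lemma genD_eq (n : ℕ) (b : Bool) :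
    genD (n + 1) b = qInt (n + 1) * ∏ i ∈ range n, qInt (2 * (i + 1)) := by
  induction n generalizing b with
  | zero =>
    rw [genD_succ, genD, genD, Fintype.sum_subsingleton _ (bone 0),
      Fintype.sum_subsingleton _ (bone 0), statD_bone, N1_bone]
    cases b <;> simp [qInt]
  | succ n ih =>
    rw [genD_succ, ih, ih, Finset.prod_range_succ, qInt_two_mul]
    ring

/-- Biagioli–Caselli: `Dmaj` is Mahonian on `D_n`:
`∑_{γ ∈ Δ_n} q^{Dmaj γ} = ∑_{γ ∈ D_n} q^{ℓ_D γ}`. -/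
theorem stmt11 (n : ℕ) (hn : 0 < n) :
    ∑ γ ∈ DeltaSet n, (X : Polynomial ℤ) ^ Dmaj γ =
      ∑ γ ∈ Dgrp n, (X : Polynomial ℤ) ^ lenD γ := by
  obtain ⟨m, rfl⟩ : ∃ m, n = m + 1 := ⟨n - 1, by omega⟩
  rw [sum_DeltaSet_X_pow_Dmaj, ← genD_eq m false, genD, ← Finset.sum_filter, Dgrp]
  simp only [Bool.toNat_false, ← Nat.even_iff]
  refine Finset.sum_congr rfl fun γ hγ => ?_
  rw [lenD_eq_statD γ (Finset.mem_filter.1 hγ).2]
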